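/- Let n ≥ 5 and let P, Q : Fin n → ℝ² be two configurations of n labeled points (injective, in general position) with the same undirected radial system, i.e., for every index i the relation ccw_Q(i;·,·,·) equals ccw_P(i;·,·,·) or its reverse. If the extreme set of P has exactly 3 elements, then the extreme set of Q also has exactly 3 elements. -/

import Mathlib

noncomputable def det2 (v w : ℝ × ℝ) : ℝ := v.1 * w.2 - v.2 * w.1

noncomputable def chi {α : Type*} (P : α → ℝ × ℝ) (i j k : α) : ℝ :=
  Real.sign (det2 (P j - P i) (P k - P i))

def GenPos {α : Type*} (P : α → ℝ × ℝ) : Prop :=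
  ∀ i j k : α, i ≠ j → i ≠ k → j ≠ k → chi P i j k ≠ 0

def Ccw {α : Type*} (P : α → ℝ × ℝ) (i j k l : α) : Prop :=
  (chi P i j k = 1 ∧ chi P i k l = 1) ∨
  (chi P i k l = 1 ∧ chi P i l j = 1) ∨
  (chi P i l j = 1 ∧ chi P i j k = 1)

def Admissible {α : Type*} (i j k l : α) : Prop :=
  i ≠ j ∧ i ≠ k ∧ i ≠ l ∧ j ≠ k ∧ j ≠ l ∧ k ≠ l

def SameRadial {α : Type*} (P Q : α → ℝ × ℝ) : Prop :=
  ∀ i j k l : α, Admissible i j k l → (Ccw P i j k l ↔ Ccw Q i j k l)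

def SameUndirected {α : Type*} (P Q : α → ℝ × ℝ) : Prop :=
  ∀ i : α, (∀ j k l : α, Admissible i j k l → (Ccw Q i j k l ↔ Ccw P i j k l)) ∨
           (∀ j k l : α, Admissible i j k l → (Ccw Q i j k l ↔ Ccw P i l k j))

def ExtremeSet {α : Type*} (P : α → ℝ × ℝ) : Set α :=
  {i | P i ∉ convexHull ℝ (P '' {j | j ≠ i})}

def Important {n : ℕ} (P₀ : Fin n → ℝ × ℝ) (H : Set (Fin n)) : Prop :=
  ∃ Q : Fin n → ℝ × ℝ, Function.Injective Q ∧ GenPos Q ∧ SameRadial P₀ Q ∧ ExtremeSet Q = H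

def lineThrough (p q : ℝ × ℝ) : Set (ℝ × ℝ) := {x | ∃ t : ℝ, x = p + t • (q - p)}

/-- Twice the signed area of the triangle `P i, P j, P k`. -/
noncomputable def orient {α : Type*} (P : α → ℝ × ℝ) (i j k : α) : ℝ :=
  det2 (P j - P i) (P k - P i)

section Orientation

variable {α : Type*} {P : α → ℝ × ℝ}

theorem orient_rotate (i j k : α) : orient P j k i = orient P i j k := by
  simp only [orient, det2, Prod.fst_sub, Prod.snd_sub]; ring

theorem orient_swap (i j k : α) : orient P i k j = -orient P i j k := by
  simp only [orient, det2]; ring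

theorem orient_decompose (u v w x : α) :
    orient P u v w = orient P v w x + orient P w u x + orient P u v x := by
  simp only [orient, det2, Prod.fst_sub, Prod.snd_sub]; ring

theorem orient_grassmann (i j k l m : α) :
    orient P i j k * orient P i l m - orient P i j l * orient P i k m
      + orient P i j m * orient P i k l = 0 := by
  simp only [orient, det2]; ring

theorem orient_ne_zero (h : GenPos P) {i j k : α} (hij : i ≠ j) (hik : i ≠ k) (hjk : j ≠ k) :
    orient P i j k ≠ 0 := by
  intro h0
  apply h i j k hij hik hjk
  rw [chi, ← orient, h0, Real.sign_zero]

theorem chi_eq_one_iff (i j k : α) : chi P i j k = 1 ↔ 0 < orient P i j k := by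
  rw [chi, ← orient]
  rcases lt_trichotomy (orient P i j k) 0 with h | h | h
  · rw [Real.sign_of_neg h]
    constructor <;> intro h' <;> linarith
  · simp [h]
  · simp [Real.sign_of_pos h, h]

/-- The linear part of `x ↦ det2 v x`. -/
noncomputable def detLin (v : ℝ × ℝ) : ℝ × ℝ →ₗ[ℝ] ℝ :=
  v.1 • LinearMap.snd ℝ ℝ ℝ - v.2 • LinearMap.fst ℝ ℝ ℝ

theorem detLin_sub_detLin (i j k l : α) :
    detLin (P j - P i) (P k) - detLin (P j - P i) (P l) = orient P i j k - orient P i j l := by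
  simp [detLin, orient, det2]; ring

theorem orient_nonneg_of_mem_convexHull {i j x : α} {S : Set α}
    (hS : ∀ t ∈ S, 0 ≤ orient P i j t) (hx : P x ∈ convexHull ℝ (P '' S)) :
    0 ≤ orient P i j x := by
  have hii : orient P i j i = 0 := by simp [orient, det2]
  have hsub : P '' S ⊆ {y | detLin (P j - P i) (P i) ≤ detLin (P j - P i) y} := by
    rintro _ ⟨t, ht, rfl⟩
    have := detLin_sub_detLin (P := P) i j t i
    have := hS t ht
    simp only [Set.mem_ofPred_eq]
    linarith
  have hmem := convexHull_min hsub
    (convex_halfSpace_ge (detLin (P j - P i)).isLinear (detLin (P j - P i) (P i))) hx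
  have := detLin_sub_detLin (P := P) i j x i
  simp only [Set.mem_ofPred_eq] at hmem
  linarith

theorem mem_convexHull_of_orient {u v w x : α} (h : 0 < orient P u v w)
    (hu : 0 ≤ orient P v w x) (hv : 0 ≤ orient P w u x) (hw : 0 ≤ orient P u v x) :
    P x ∈ convexHull ℝ {P u, P v, P w} := by
  have hsum := orient_decompose (P := P) u v w x
  have hmem : ∀ y ∈ ({P u, P v, P w} : Set (ℝ × ℝ)), y ∈ convexHull ℝ {P u, P v, P w} :=
    fun y hy => subset_convexHull ℝ _ hy
  have key := (convex_convexHull ℝ ({P u, P v, P w} : Set (ℝ × ℝ))).sum_mem (t := Finset.univ)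
    (w := ![orient P v w x / orient P u v w, orient P w u x / orient P u v w,
      orient P u v x / orient P u v w]) (z := ![P u, P v, P w])
    (by intro i _; fin_cases i <;> simp <;> positivity)
    (by rw [Fin.sum_univ_three]; simp; field_simp; linarith)
    (by intro i _; fin_cases i <;> apply hmem <;> simp)
  convert key using 1
  rw [Fin.sum_univ_three]
  have hne := h.ne'
  ext
  · simp
    field_simp
    simp [orient, det2]; ring
  · simp
    field_simp
    simp [orient, det2]; ring

/-- A point that strictly maximises a linear functional over a finite configuration is not a
convex combination of other points of its hull. -/
theorem notMem_convexHull_of_strict_max (f : ℝ × ℝ →ₗ[ℝ] ℝ) {p : ℝ × ℝ} {S T : Set (ℝ × ℝ)}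
    (hS : ∀ x ∈ S, x = p ∨ f x < f p) (hT : T ⊆ convexHull ℝ S) (hp : p ∉ T) :
    p ∉ convexHull ℝ T := by
  have hconv : Convex ℝ {x | x = p ∨ f x < f p} := by
    intro x hx y hy a b ha hb hab
    simp only [Set.mem_ofPred_eq] at hx hy ⊢
    rcases hx with rfl | hx <;> rcases hy with rfl | hy
    · left; rw [← add_smul, hab, one_smul]
    · rcases hb.eq_or_lt with rfl | hb
      · left; simp_all
      · right
        simp only [map_add, map_smul, smul_eq_mul]
        have : a = 1 - b := by linarith
        subst this
        nlinarith
    · rcases ha.eq_or_lt with rfl | ha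
      · left; simp_all
      · right
        simp only [map_add, map_smul, smul_eq_mul]
        have : b = 1 - a := by linarith
        subst this
        nlinarith
    · right
      simp only [map_add, map_smul, smul_eq_mul]
      have : b = 1 - a := by linarith
      subst this
      rcases ha.eq_or_lt with rfl | ha
      · simpa using hy
      · nlinarith [mul_nonneg hb (sub_nonneg.2 hy.le), mul_pos ha (sub_pos.2 hx)]
  have hS' := convexHull_min hS hconv
  have hT' : T ⊆ {x | f x < f p} := by
    intro x hx
    rcases hS' (hT hx) with rfl | h
    · exact absurd hx hp
    · exact h
  intro hmem
  have := convexHull_min hT' (convex_halfSpace_lt f.isLinear (f p)) hmem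
  simp at this

theorem range_subset_convexHull_extremeSet [Finite α] (hP : Function.Injective P) :
    Set.range P ⊆ convexHull ℝ (P '' ExtremeSet P) := by
  have hfin : (Set.range P).Finite := Set.finite_range P
  have hKM := closure_convexHull_extremePoints (hfin.isCompact_convexHull (𝕜 := ℝ))
    (convex_convexHull ℝ _)
  have hsub : (convexHull ℝ (Set.range P)).extremePoints ℝ ⊆ P '' ExtremeSet P := by
    intro x hx
    obtain ⟨i, rfl⟩ := extremePoints_convexHull_subset hx
    refine ⟨i, fun hi => ?_, rfl⟩
    rw [(convex_convexHull ℝ _).mem_extremePoints_iff_mem_sdiff_convexHull_sdiff] at hx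
    refine hx.2 (convexHull_mono ?_ hi)
    rintro _ ⟨j, hj, rfl⟩
    exact ⟨subset_convexHull ℝ _ ⟨j, rfl⟩, fun h => hj (hP h)⟩
  refine (subset_convexHull ℝ _).trans ?_
  rw [← hKM]
  exact closure_minimal (convexHull_mono hsub)
    ((Set.toFinite (P '' ExtremeSet P)).isClosed_convexHull (𝕜 := ℝ))

end Orientation

section FivePoints

variable {α : Type*} {P Q : α → ℝ × ℝ}

/-- Whether the triple `i, j, k` is positively oriented. -/
noncomputable def turnsLeft (P : α → ℝ × ℝ) (i j k : α) : Bool := decide (0 < orient P i j k)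

/-- The majority function of three Booleans. -/
def majority (x y z : Bool) : Bool := (x && y) || (y && z) || (z && x)

/-- The radial order at `i` as a Boolean. -/
noncomputable def radial (P : α → ℝ × ℝ) (i j k l : α) : Bool :=
  majority (turnsLeft P i j k) (turnsLeft P i k l) (turnsLeft P i l j)

theorem ccw_iff_radial (i j k l : α) : Ccw P i j k l ↔ radial P i j k l = true := by
  simp [Ccw, radial, majority, turnsLeft, chi_eq_one_iff, or_assoc]

theorem turnsLeft_rotate (i j k : α) : turnsLeft P j k i = turnsLeft P i j k := by
  simp [turnsLeft, orient_rotate]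

theorem turnsLeft_swap (h : GenPos P) {i j k : α} (hij : i ≠ j) (hik : i ≠ k) (hjk : j ≠ k) :
    turnsLeft P i k j = !turnsLeft P i j k := by
  have := orient_ne_zero h hij hik hjk
  simp only [turnsLeft, orient_swap i j k, Left.neg_pos_iff]
  rw [Bool.eq_not]
  intro h'
  rw [decide_eq_decide] at h'
  rcases lt_or_gt_of_ne this with h1 | h1
  · exact lt_asymm h1 (h'.1 h1)
  · exact lt_asymm h1 (h'.2 h1)

theorem turnsLeft_perm (h : GenPos P) {i j k : α} (hij : i ≠ j) (hik : i ≠ k) (hjk : j ≠ k) :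
    turnsLeft P i k j = (!turnsLeft P i j k) ∧ turnsLeft P j k i = turnsLeft P i j k ∧
    turnsLeft P k i j = turnsLeft P i j k ∧ turnsLeft P j i k = (!turnsLeft P i j k) ∧
    turnsLeft P k j i = !turnsLeft P i j k := by
  have h1 := turnsLeft_swap h hij hik hjk
  refine ⟨h1, turnsLeft_rotate i j k, ?_, ?_, ?_⟩
  · rw [turnsLeft_rotate, turnsLeft_rotate]
  · rw [← h1, ← turnsLeft_rotate i k j, ← turnsLeft_rotate k j i]
  · rw [← h1, ← turnsLeft_rotate i k j]

theorem radial_reverse (h : GenPos P) {i j k l : α} (ha : Admissible i j k l) :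
    radial P i l k j = !radial P i j k l := by
  obtain ⟨hij, hik, hil, hjk, hjl, hkl⟩ := ha
  rw [radial, radial, turnsLeft_swap h hik hil hkl, turnsLeft_swap h hij hik hjk,
    turnsLeft_swap h hil hij hjl.symm]
  generalize turnsLeft P i j k = x
  generalize turnsLeft P i k l = y
  generalize turnsLeft P i l j = z
  revert x y z
  decide

theorem SameUndirected.exists_xor (hU : SameUndirected P Q) (hP : GenPos P) (i : α) :
    ∃ e : Bool, ∀ j k l : α, Admissible i j k l →
      (radial Q i j k l ^^ radial P i j k l) = e := by
  rcases hU i with h | h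
  · refine ⟨false, fun j k l ha => ?_⟩
    have := h j k l ha
    rw [ccw_iff_radial, ccw_iff_radial, ← Bool.eq_iff_iff] at this
    rw [this, Bool.xor_self]
  · refine ⟨true, fun j k l ha => ?_⟩
    have := h j k l ha
    rw [ccw_iff_radial, ccw_iff_radial, ← Bool.eq_iff_iff, radial_reverse hP ha] at this
    rw [this, Bool.not_xor_self]

theorem turnsLeft_grassmann (h : GenPos P) {i j k l m : α} (hij : i ≠ j) (hik : i ≠ k)
    (hil : i ≠ l) (him : i ≠ m) (hjk : j ≠ k) (hjl : j ≠ l) (hjm : j ≠ m) (hkl : k ≠ l)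
    (hkm : k ≠ m) (hlm : l ≠ m) :
    ¬((turnsLeft P i j k ^^ turnsLeft P i l m) = (turnsLeft P i j m ^^ turnsLeft P i k l) ∧
      (turnsLeft P i j k ^^ turnsLeft P i l m) = !(turnsLeft P i j l ^^ turnsLeft P i k m)) := by
  have hg := orient_grassmann (P := P) i j k l m
  have h1 := orient_ne_zero h hij hik hjk
  have h2 := orient_ne_zero h hil him hlm
  have h3 := orient_ne_zero h hij hil hjl
  have h4 := orient_ne_zero h hik him hkm
  have h5 := orient_ne_zero h hij him hjm
  have h6 := orient_ne_zero h hik hil hkl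
  simp only [turnsLeft]
  generalize orient P i j k = a at *
  generalize orient P i l m = b at *
  generalize orient P i j l = c at *
  generalize orient P i k m = d at *
  generalize orient P i j m = e at *
  generalize orient P i k l = f at *
  have key : ∀ x y : ℝ, x ≠ 0 → y ≠ 0 →
      ((decide (0 < x) ^^ decide (0 < y)) = decide (x * y < 0)) := by
    intro x y hx hy
    rcases lt_or_gt_of_ne hx with hx | hx <;> rcases lt_or_gt_of_ne hy with hy | hy
    · simp [hx.le, hy.le, not_lt.2 hx.le, not_lt.2 hy.le, mul_nonneg_of_nonpos_of_nonpos]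
    · simp [hy, not_lt.2 hx.le, mul_neg_of_neg_of_pos hx hy]
    · simp [hx, not_lt.2 hy.le, mul_neg_of_pos_of_neg hx hy]
    · simp [hx, hy, hy.le]
  rw [key a b h1 h2, key c d h3 h4, key e f h5 h6]
  have hab := mul_ne_zero h1 h2
  have hcd := mul_ne_zero h3 h4
  have hef := mul_ne_zero h5 h6
  rintro ⟨hx, hy⟩
  rw [decide_eq_decide] at hx
  rw [← decide_not, decide_eq_decide] at hy
  rcases lt_or_gt_of_ne hab with hab | hab
  · have := hx.1 hab
    have := hy.1 hab
    linarith
  · have h7 : ¬ a * b < 0 := hab.not_gt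
    rw [hx] at h7
    rw [hx] at hy
    have : c * d < 0 := by tauto
    linarith

theorem turnsLeft_interior (h : GenPos P) {u v w x : α} (huv : u ≠ v) (huw : u ≠ w)
    (hvw : v ≠ w) (hux : u ≠ x) (hvx : v ≠ x) (hwx : w ≠ x) :
    ¬(turnsLeft P v w x = turnsLeft P w u x ∧ turnsLeft P w u x = turnsLeft P u v x ∧
      turnsLeft P u v x = !turnsLeft P u v w) := by
  have hd := orient_decompose (P := P) u v w x
  have h1 := orient_ne_zero h huv huw hvw
  have h2 := orient_ne_zero h hvw hvx hwx
  have h3 := orient_ne_zero h huw.symm hwx hux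
  have h4 := orient_ne_zero h huv hux hvx
  simp only [turnsLeft, ← decide_not, decide_eq_decide]
  rintro ⟨h5, h6, h7⟩
  by_cases h0 : 0 < orient P u v w
  · have h8 : ¬ 0 < orient P u v x := fun h => h7.1 h h0
    have h9 := mt h6.1 h8
    have := mt h5.1 h9
    linarith
  · have h8 := h7.2 h0
    have h9 := h6.2 h8
    have := h5.2 h9
    linarith

theorem mem_convexHull_of_turnsLeft (h : GenPos P) {u v w x : α} (huv : u ≠ v) (huw : u ≠ w)
    (hvw : v ≠ w)
    (h1 : turnsLeft P u v x = turnsLeft P u v w) (h2 : turnsLeft P v w x = turnsLeft P u v w)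
    (h3 : turnsLeft P w u x = turnsLeft P u v w) :
    P x ∈ convexHull ℝ {P u, P v, P w} := by
  simp only [turnsLeft, decide_eq_decide] at h1 h2 h3
  rcases lt_or_gt_of_ne (orient_ne_zero h huv huw hvw) with hneg | hpos
  · rw [Set.pair_comm]
    have e1 := orient_swap (P := P) u v w
    have h1' := mt h1.1 hneg.not_gt
    have h2' := mt h2.1 hneg.not_gt
    have h3' := mt h3.1 hneg.not_gt
    have e2 := orient_swap (P := P) u v x
    have e3 := orient_swap (P := P) v w x
    have e4 := orient_swap (P := P) w u x
    have f2 := orient_rotate (P := P) v u x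
    have f3 := orient_rotate (P := P) w v x
    have f4 := orient_rotate (P := P) u w x
    have g2 := orient_rotate (P := P) x v u
    have g3 := orient_rotate (P := P) x w v
    have g4 := orient_rotate (P := P) x u w
    apply mem_convexHull_of_orient <;> linarith
  · exact mem_convexHull_of_orient hpos (h2.2 hpos).le (h3.2 hpos).le (h1.2 hpos).le

set_option maxRecDepth 100000 in
set_option synthInstance.maxSize 100000 in
set_option synthInstance.maxHeartbeats 1000000 in
theorem triangular_of_radial_signature : ∀ abc abd abe acd ace ade bcd bce bde cde : Bool,
    ¬(bcd = (!acd) ∧ (!acd) = abd ∧ abd = !abc) →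
    ¬(bce = (!ace) ∧ (!ace) = abe ∧ abe = !abc) →
    ¬(bde = (!ade) ∧ (!ade) = abe ∧ abe = !abd) →
    ¬(cde = (!ade) ∧ (!ade) = ace ∧ ace = !acd) →
    ¬(cde = (!bde) ∧ (!bde) = bce ∧ bce = !bcd) →
    ¬((abc ^^ ade) = (abe ^^ acd) ∧ (abc ^^ ade) = !(abd ^^ ace)) →
    ¬(((!abc) ^^ bde) = ((!abe) ^^ bcd) ∧ ((!abc) ^^ bde) = !((!abd) ^^ bce)) →
    ¬((abc ^^ cde) = ((!ace) ^^ (!bcd)) ∧ (abc ^^ cde) = !((!acd) ^^ (!bce))) →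
    ¬((abd ^^ (!cde)) = ((!ade) ^^ bcd) ∧ (abd ^^ (!cde)) = !(acd ^^ (!bde))) →
    ¬((abe ^^ cde) = (ade ^^ bce) ∧ (abe ^^ cde) = !(ace ^^ bde)) →
    (majority abc acd (!abd) ^^ false) = (majority abc ace (!abe) ^^ false) ∧
      (majority abc ace (!abe) ^^ false) = (majority abd ade (!abe) ^^ true) ∧
      (majority abd ade (!abe) ^^ true) = (majority acd ade (!ace) ^^ true) →
    (majority (!abc) bcd abd ^^ true) = (majority (!abc) bce abe ^^ true) ∧
      (majority (!abc) bce abe ^^ true) = (majority (!abd) bde abe ^^ false) ∧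
      (majority (!abd) bde abe ^^ false) = (majority bcd bde (!bce) ^^ false) →
    (majority abc (!bcd) acd ^^ false) = (majority abc (!bce) ace ^^ false) ∧
      (majority abc (!bce) ace ^^ false) = (majority (!acd) cde ace ^^ false) ∧
      (majority (!acd) cde ace ^^ false) = (majority (!bcd) cde bce ^^ false) →
    (majority abd bcd (!acd) ^^ true) = (majority abd (!bde) ade ^^ true) ∧
      (majority abd (!bde) ade ^^ true) = (majority acd (!cde) ade ^^ true) ∧
      (majority acd (!cde) ade ^^ true) = (majority bcd (!cde) bde ^^ true) →
    (majority abe bce (!ace) ^^ true) = (majority abe bde (!ade) ^^ false) ∧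
      (majority abe bde (!ade) ^^ false) = (majority ace cde (!ade) ^^ false) ∧
      (majority ace cde (!ade) ^^ false) = (majority bce cde (!bde) ^^ true) →
    (abd = abc ∧ bcd = abc ∧ (!acd) = abc ∧ abe = abc ∧ bce = abc ∧ (!ace) = abc) ∨
      (abc = abd ∧ (!bcd) = abd ∧ acd = abd ∧ abe = abd ∧ bde = abd ∧ (!ade) = abd) ∨
      ((!abc) = ace ∧ bce = ace ∧ abe = ace ∧ acd = ace ∧ (!cde) = ace ∧ ade = ace) ∨
      ((!abd) = ade ∧ bde = ade ∧ abe = ade ∧ (!acd) = ade ∧ cde = ade ∧ ace = ade) := by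
  decide

/-- The hull of the points of `Q` indexed by `S` is a triangle with vertices among these points. -/
def HasTriangularHull (Q : α → ℝ × ℝ) (S : Set α) : Prop :=
  ∃ T : Finset α, T.card = 3 ∧ (T : Set α) ⊆ S ∧ ∀ t ∈ S, Q t ∈ convexHull ℝ (Q '' T)

theorem hasTriangularHull_of_triple {S : Set α} {u v w : α} (huv : u ≠ v) (huw : u ≠ w)
    (hvw : v ≠ w) (hu : u ∈ S) (hv : v ∈ S) (hw : w ∈ S)
    (h : ∀ t ∈ S, Q t ∈ convexHull ℝ {Q u, Q v, Q w}) : HasTriangularHull Q S := by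
  classical
  refine ⟨{u, v, w}, Finset.card_eq_three.2 ⟨u, v, w, huv, huw, hvw, rfl⟩, ?_, ?_⟩
  · simp [Set.insert_subset_iff, hu, hv, hw]
  · simpa [Set.image_insert_eq] using h

theorem SameUndirected.radial_xor_eq (hU : SameUndirected P Q) (hP : GenPos P) {i j k l m : α}
    (hij : i ≠ j) (hik : i ≠ k) (hil : i ≠ l) (him : i ≠ m) (hjk : j ≠ k) (hjl : j ≠ l)
    (hjm : j ≠ m) (hkl : k ≠ l) (hkm : k ≠ m) (hlm : l ≠ m) :
    (radial Q i j k l ^^ radial P i j k l) = (radial Q i j k m ^^ radial P i j k m) ∧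
      (radial Q i j k m ^^ radial P i j k m) = (radial Q i j l m ^^ radial P i j l m) ∧
      (radial Q i j l m ^^ radial P i j l m) = (radial Q i k l m ^^ radial P i k l m) := by
  obtain ⟨ε, h⟩ := hU.exists_xor hP i
  rw [h j k l ⟨hij, hik, hil, hjk, hjl, hkl⟩, h j k m ⟨hij, hik, him, hjk, hjm, hkm⟩,
    h j l m ⟨hij, hil, him, hjl, hjm, hlm⟩, h k l m ⟨hik, hil, him, hkl, hkm, hlm⟩]
  simp

set_option linter.unusedSimpArgs false in
/-- Five points of `P` in canonical position: `d` and `e` lie in the positively oriented triangle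
`a, b, c`, the line through `d` and `e` separates `a` from `b` and `c`, and `a` is to its left. -/
theorem SameUndirected.triangular_of_canonical (hU : SameUndirected P Q) (hP : GenPos P)
    (hQ : GenPos Q) {a b c d e : α} (hab : a ≠ b) (hac : a ≠ c) (had : a ≠ d) (hae : a ≠ e)
    (hbc : b ≠ c) (hbd : b ≠ d) (hbe : b ≠ e) (hcd : c ≠ d) (hce : c ≠ e) (hde : d ≠ e)
    (habc : turnsLeft P a b c = true) (habd : turnsLeft P a b d = true)
    (habe : turnsLeft P a b e = true) (hacd : turnsLeft P a c d = false)
    (hace : turnsLeft P a c e = false) (hade : turnsLeft P a d e = true)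
    (hbcd : turnsLeft P b c d = true) (hbce : turnsLeft P b c e = true)
    (hbde : turnsLeft P b d e = false) (hcde : turnsLeft P c d e = false) :
    HasTriangularHull Q {a, b, c, d, e} := by
  have gp1 := turnsLeft_grassmann hQ hab hac had hae hbc hbd hbe hcd hce hde
  have gp2 := turnsLeft_grassmann hQ hab.symm hbc hbd hbe hac had hae hcd hce hde
  have gp3 := turnsLeft_grassmann hQ hac.symm hbc.symm hcd hce hab had hae hbd hbe hde
  have gp4 := turnsLeft_grassmann hQ had.symm hbd.symm hcd.symm hde hab hac hae hbc hbe hce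
  have gp5 := turnsLeft_grassmann hQ hae.symm hbe.symm hce.symm hde.symm hab hac had hbc hbd hcd
  have in1 := turnsLeft_interior hQ hab hac hbc had hbd hcd
  have in2 := turnsLeft_interior hQ hab hac hbc hae hbe hce
  have in3 := turnsLeft_interior hQ hab had hbd hae hbe hde
  have in4 := turnsLeft_interior hQ hac had hcd hae hce hde
  have in5 := turnsLeft_interior hQ hbc hbd hcd hbe hce hde
  have ra := hU.radial_xor_eq hP hab hac had hae hbc hbd hbe hcd hce hde
  have rb := hU.radial_xor_eq hP hab.symm hbc hbd hbe hac had hae hcd hce hde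
  have rc := hU.radial_xor_eq hP hac.symm hbc.symm hcd hce hab had hae hbd hbe hde
  have rd := hU.radial_xor_eq hP had.symm hbd.symm hcd.symm hde hab hac hae hbc hbe hce
  have re := hU.radial_xor_eq hP hae.symm hbe.symm hce.symm hde.symm hab hac had hbc hbd hcd
  have pP1 := turnsLeft_perm hP hab hac hbc
  have pP2 := turnsLeft_perm hP hab had hbd
  have pP3 := turnsLeft_perm hP hab hae hbe
  have pP4 := turnsLeft_perm hP hac had hcd
  have pP5 := turnsLeft_perm hP hac hae hce
  have pP6 := turnsLeft_perm hP had hae hde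
  have pP7 := turnsLeft_perm hP hbc hbd hcd
  have pP8 := turnsLeft_perm hP hbc hbe hce
  have pP9 := turnsLeft_perm hP hbd hbe hde
  have pP10 := turnsLeft_perm hP hcd hce hde
  have pQ1 := turnsLeft_perm hQ hab hac hbc
  have pQ2 := turnsLeft_perm hQ hab had hbd
  have pQ3 := turnsLeft_perm hQ hab hae hbe
  have pQ4 := turnsLeft_perm hQ hac had hcd
  have pQ5 := turnsLeft_perm hQ hac hae hce
  have pQ6 := turnsLeft_perm hQ had hae hde
  have pQ7 := turnsLeft_perm hQ hbc hbd hcd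
  have pQ8 := turnsLeft_perm hQ hbc hbe hce
  have pQ9 := turnsLeft_perm hQ hbd hbe hde
  have pQ10 := turnsLeft_perm hQ hcd hce hde
  simp only [radial, pP1, pP2, pP3, pP4, pP5, pP6, pP7, pP8, pP9, pP10,
    habc, habd, habe, hacd, hace, hade, hbcd, hbce, hbde, hcde,
    pQ1, pQ2, pQ3, pQ4, pQ5, pQ6, pQ7, pQ8, pQ9, pQ10]
    at ra rb rc rd re gp1 gp2 gp3 gp4 gp5 in1 in2 in3 in4 in5
  have core := triangular_of_radial_signature _ _ _ _ _ _ _ _ _ _ in1 in2 in3 in4 in5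
    gp1 gp2 gp3 gp4 gp5 ra rb rc rd re
  have tri {u v w : α} (huv : u ≠ v) (huw : u ≠ w) (hvw : v ≠ w) :=
    hasTriangularHull_of_triple (Q := Q) (S := {a, b, c, d, e}) huv huw hvw
  have vert {u v w : α} : Q u ∈ convexHull ℝ {Q u, Q v, Q w} ∧
      Q v ∈ convexHull ℝ {Q u, Q v, Q w} ∧ Q w ∈ convexHull ℝ {Q u, Q v, Q w} := by
    refine ⟨?_, ?_, ?_⟩ <;> apply subset_convexHull <;> simp
  have inside {u v w x : α} (huv : u ≠ v) (huw : u ≠ w) (hvw : v ≠ w) :=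
    mem_convexHull_of_turnsLeft (x := x) hQ huv huw hvw
  rcases core with ⟨h1, h2, h3, h4, h5, h6⟩ | ⟨h1, h2, h3, h4, h5, h6⟩ |
    ⟨h1, h2, h3, h4, h5, h6⟩ | ⟨h1, h2, h3, h4, h5, h6⟩
  · refine tri hab hac hbc (by simp) (by simp) (by simp) ?_
    simp only [Set.mem_insert_iff, Set.mem_singleton_iff, forall_eq_or_imp, forall_eq]
    refine ⟨vert.1, vert.2.1, vert.2.2, inside hab hac hbc ?_ ?_ ?_, inside hab hac hbc ?_ ?_ ?_⟩
      <;> first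
        | assumption
        | simp only [pQ1, pQ2, pQ3, pQ4, pQ5, pQ6, pQ7, pQ8, pQ9, pQ10]; assumption
  · refine tri hab had hbd (by simp) (by simp) (by simp) ?_
    simp only [Set.mem_insert_iff, Set.mem_singleton_iff, forall_eq_or_imp, forall_eq]
    refine ⟨vert.1, vert.2.1, inside hab had hbd ?_ ?_ ?_, vert.2.2, inside hab had hbd ?_ ?_ ?_⟩
      <;> first
        | assumption
        | simp only [pQ1, pQ2, pQ3, pQ4, pQ5, pQ6, pQ7, pQ8, pQ9, pQ10]; assumption
  · refine tri hac hae hce (by simp) (by simp) (by simp) ?_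
    simp only [Set.mem_insert_iff, Set.mem_singleton_iff, forall_eq_or_imp, forall_eq]
    refine ⟨vert.1, inside hac hae hce ?_ ?_ ?_, vert.2.1, inside hac hae hce ?_ ?_ ?_, vert.2.2⟩
      <;> first
        | assumption
        | simp only [pQ1, pQ2, pQ3, pQ4, pQ5, pQ6, pQ7, pQ8, pQ9, pQ10]; assumption
  · refine tri had hae hde (by simp) (by simp) (by simp) ?_
    simp only [Set.mem_insert_iff, Set.mem_singleton_iff, forall_eq_or_imp, forall_eq]
    refine ⟨vert.1, inside had hae hde ?_ ?_ ?_, inside had hae hde ?_ ?_ ?_, vert.2.1, vert.2.2⟩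
      <;> first
        | assumption
        | simp only [pQ1, pQ2, pQ3, pQ4, pQ5, pQ6, pQ7, pQ8, pQ9, pQ10]; assumption

theorem SameUndirected.triangular_of_turnsLeft (hU : SameUndirected P Q) (hP : GenPos P)
    (hQ : GenPos Q) {a b c d e : α} (hab : a ≠ b) (hac : a ≠ c) (had : a ≠ d) (hae : a ≠ e)
    (hbc : b ≠ c) (hbd : b ≠ d) (hbe : b ≠ e) (hcd : c ≠ d) (hce : c ≠ e) (hde : d ≠ e)
    (habc : turnsLeft P a b c = true) (habd : turnsLeft P a b d = true)
    (hbcd : turnsLeft P b c d = true) (hcad : turnsLeft P c a d = true)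
    (habe : turnsLeft P a b e = true) (hbce : turnsLeft P b c e = true)
    (hcae : turnsLeft P c a e = true) :
    HasTriangularHull Q {a, b, c, d, e} := by
  have base {a b c d e : α} (hab : a ≠ b) (hac : a ≠ c) (had : a ≠ d) (hae : a ≠ e)
      (hbc : b ≠ c) (hbd : b ≠ d) (hbe : b ≠ e) (hcd : c ≠ d) (hce : c ≠ e) (hde : d ≠ e)
      (habc : turnsLeft P a b c = true) (habd : turnsLeft P a b d = true)
      (hbcd : turnsLeft P b c d = true) (hcad : turnsLeft P c a d = true)
      (habe : turnsLeft P a b e = true) (hbce : turnsLeft P b c e = true)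
      (hcae : turnsLeft P c a e = true) (hade : turnsLeft P a d e = true)
      (hbde : turnsLeft P b d e = false) (hcde : turnsLeft P c d e = false) :
      HasTriangularHull Q {a, b, c, d, e} := by
    have h1 := turnsLeft_perm hP hac had hcd
    have h2 := turnsLeft_perm hP hac hae hce
    exact hU.triangular_of_canonical hP hQ hab hac had hae hbc hbd hbe hcd hce hde habc habd habe
      (by grind) (by grind) hade hbcd hbce hbde hcde
  have h1 := turnsLeft_perm hP hab hac hbc
  have h2 := turnsLeft_perm hP had hae hde
  have h3 := turnsLeft_perm hP hbd hbe hde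
  have h4 := turnsLeft_perm hP hcd hce hde
  have h5 := turnsLeft_perm hP hab had hbd
  have h6 := turnsLeft_perm hP hbc hbd hcd
  have h7 := turnsLeft_perm hP hac had hcd
  have hg := turnsLeft_grassmann hP had.symm hbd.symm hcd.symm hde hab hac hae hbc hbe hce
  have s1 : ({a, b, c, e, d} : Set α) = {a, b, c, d, e} := by rw [Set.pair_comm e d]
  have s2 : ({b, c, a, d, e} : Set α) = {a, b, c, d, e} := by
    rw [Set.insert_comm c a, Set.insert_comm b a]
  have s3 : ({b, c, a, e, d} : Set α) = {a, b, c, d, e} := by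
    rw [Set.pair_comm e d, Set.insert_comm c a, Set.insert_comm b a]
  have s4 : ({c, a, b, d, e} : Set α) = {a, b, c, d, e} := by
    rw [Set.insert_comm c a, Set.insert_comm c b]
  have s5 : ({c, a, b, e, d} : Set α) = {a, b, c, d, e} := by
    rw [Set.pair_comm e d, Set.insert_comm c a, Set.insert_comm c b]
  cases ha : turnsLeft P a d e <;> cases hb : turnsLeft P b d e <;>
    cases hc : turnsLeft P c d e
  · grind
  · rw [← s4]; apply base <;> grind
  · rw [← s2]; apply base <;> grind
  · rw [← s1]; apply base <;> grind
  · apply base <;> grind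
  · rw [← s3]; apply base <;> grind
  · rw [← s5]; apply base <;> grind
  · grind

theorem turnsLeft_of_mem_convexHull (hP : GenPos P) {a b c d : α} (hab : a ≠ b) (had : a ≠ d)
    (hbd : b ≠ d) (habc : turnsLeft P a b c = true)
    (hd : P d ∈ convexHull ℝ (P '' {a, b, c})) : turnsLeft P a b d = true := by
  simp only [turnsLeft, decide_eq_true_eq] at habc ⊢
  refine lt_of_le_of_ne (orient_nonneg_of_mem_convexHull ?_ hd) (orient_ne_zero hP hab had hbd).symm
  simp only [Set.mem_insert_iff, Set.mem_singleton_iff, forall_eq_or_imp, forall_eq]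
  refine ⟨?_, ?_, habc.le⟩ <;> simp [orient, det2, mul_comm]

/-- Undirected radial systems preserve triangularity of the hull of five points. -/
theorem SameUndirected.hasTriangularHull (hU : SameUndirected P Q) (hP : GenPos P)
    (hQ : GenPos Q) {a b c d e : α} (hab : a ≠ b) (hac : a ≠ c) (had : a ≠ d) (hae : a ≠ e)
    (hbc : b ≠ c) (hbd : b ≠ d) (hbe : b ≠ e) (hcd : c ≠ d) (hce : c ≠ e) (hde : d ≠ e)
    (hd : P d ∈ convexHull ℝ (P '' {a, b, c})) (he : P e ∈ convexHull ℝ (P '' {a, b, c})) :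
    HasTriangularHull Q {a, b, c, d, e} := by
  have base {a b c : α} (hab : a ≠ b) (hac : a ≠ c) (had : a ≠ d) (hae : a ≠ e)
      (hbc : b ≠ c) (hbd : b ≠ d) (hbe : b ≠ e) (hcd : c ≠ d) (hce : c ≠ e)
      (hd : P d ∈ convexHull ℝ (P '' {a, b, c})) (he : P e ∈ convexHull ℝ (P '' {a, b, c}))
      (habc : turnsLeft P a b c = true) : HasTriangularHull Q {a, b, c, d, e} := by
    have s1 : ({a, b, c} : Set α) = {b, c, a} := by rw [Set.insert_comm a b, Set.pair_comm a c]
    have s2 : ({a, b, c} : Set α) = {c, a, b} := by rw [Set.pair_comm b c, Set.insert_comm a c]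
    have hbca : turnsLeft P b c a = true := by rw [turnsLeft_rotate, habc]
    have hcab : turnsLeft P c a b = true := by rw [turnsLeft_rotate, hbca]
    exact hU.triangular_of_turnsLeft hP hQ hab hac had hae hbc hbd hbe hcd hce hde habc
      (turnsLeft_of_mem_convexHull hP hab had hbd habc hd)
      (turnsLeft_of_mem_convexHull hP hbc hbd hcd hbca (s1 ▸ hd))
      (turnsLeft_of_mem_convexHull hP hac.symm hcd had hcab (s2 ▸ hd))
      (turnsLeft_of_mem_convexHull hP hab hae hbe habc he)
      (turnsLeft_of_mem_convexHull hP hbc hbe hce hbca (s1 ▸ he))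
      (turnsLeft_of_mem_convexHull hP hac.symm hce hae hcab (s2 ▸ he))
  cases habc : turnsLeft P a b c
  · have s1 : ({a, b, c} : Set α) = {a, c, b} := by rw [Set.pair_comm b c]
    have s2 : ({a, b, c, d, e} : Set α) = {a, c, b, d, e} := by rw [Set.insert_comm b c]
    rw [s1] at hd he
    rw [s2]
    exact base hac hab had hae hbc.symm hcd hce hbd hbe hd he
      (by rw [turnsLeft_swap hP hab hac hbc, habc, Bool.not_false])
  · exact base hab hac had hae hbc hbd hbe hcd hce hd he habc

end FivePoints


section ConvexQuadrilateral

variable {α : Type*} {Q : α → ℝ × ℝ} {p q r s : α}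

/-- The points `Q p, Q q, Q r, Q s` are the vertices of a convex quadrilateral, in
counterclockwise order. -/
structure ConvexQuad (Q : α → ℝ × ℝ) (p q r s : α) : Prop where
  pos₁ : 0 < orient Q p q r
  pos₂ : 0 < orient Q q r s
  pos₃ : 0 < orient Q r s p
  pos₄ : 0 < orient Q s p q

theorem orient_self_left (i j : α) : orient Q i j i = 0 := by simp [orient, det2]

theorem orient_self_right (i j : α) : orient Q i j j = 0 := by
  simp only [orient, det2]; ring

theorem orient_self (i j : α) : orient Q i i j = 0 := by simp [orient, det2]

theorem ne_of_orient_ne_zero {i j k : α} (h : orient Q i j k ≠ 0) : i ≠ j ∧ i ≠ k ∧ j ≠ k := by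
  refine ⟨?_, ?_, ?_⟩ <;> rintro rfl
  · exact h (orient_self _ _)
  · exact h (orient_self_left _ _)
  · exact h (orient_self_right _ _)

theorem mem_of_strict_max_hull (f : ℝ × ℝ →ₗ[ℝ] ℝ) (hQ : Function.Injective Q) {p : α}
    {S T : Set α} (hS : ∀ x ∈ S, x ≠ p → f (Q x) < f (Q p))
    (hT : ∀ t ∈ T, Q t ∈ convexHull ℝ (Q '' S)) (hp : Q p ∈ convexHull ℝ (Q '' T)) : p ∈ T := by
  by_contra hpT
  refine notMem_convexHull_of_strict_max f (S := Q '' S) ?_ (Set.image_subset_iff.2 hT)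
    (fun ⟨t, ht, h⟩ => hpT (hQ h ▸ ht)) hp
  rintro _ ⟨x, hx, rfl⟩
  by_cases hxp : x = p
  · exact Or.inl (congrArg Q hxp)
  · exact Or.inr (hS x hx hxp)

namespace ConvexQuad

theorem rotate (h : ConvexQuad Q p q r s) : ConvexQuad Q q r s p :=
  ⟨h.pos₂, h.pos₃, h.pos₄, h.pos₁⟩

theorem ne (h : ConvexQuad Q p q r s) : p ≠ q ∧ p ≠ r ∧ p ≠ s ∧ q ≠ r ∧ q ≠ s ∧ r ≠ s := by
  obtain ⟨h1, h2, h3⟩ := ne_of_orient_ne_zero h.pos₁.ne'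
  obtain ⟨-, h4, h5⟩ := ne_of_orient_ne_zero h.pos₂.ne'
  obtain ⟨h6, -, -⟩ := ne_of_orient_ne_zero h.pos₄.ne'
  exact ⟨h1, h2, h6.symm, h3, h4, h5⟩

theorem mem_of_mem_hull_first (h : ConvexQuad Q p q r s) (hQ : Function.Injective Q) {T : Set α}
    (hT : ∀ t ∈ T, Q t ∈ convexHull ℝ (Q '' {p, q, r, s}))
    (hp : Q p ∈ convexHull ℝ (Q '' T)) : p ∈ T := by
  refine mem_of_strict_max_hull (detLin (Q s - Q q)) hQ ?_ hT hp
  have key (x : α) (hx : orient Q q s x ≤ 0) :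
      detLin (Q s - Q q) (Q x) < detLin (Q s - Q q) (Q p) := by
    have h1 := detLin_sub_detLin (P := Q) q s p x
    have h2 := h.pos₄
    rw [← orient_rotate, ← orient_rotate] at h2
    linarith
  simp only [Set.mem_insert_iff, Set.mem_singleton_iff, forall_eq_or_imp, forall_eq]
  refine ⟨fun h => absurd rfl h, fun _ => key _ (orient_self_left _ _).le, fun _ => key _ ?_,
    fun _ => key _ (orient_self_right _ _).le⟩
  rw [orient_swap]
  linarith [h.pos₂]

theorem mem_of_mem_hull (h : ConvexQuad Q p q r s) (hQ : Function.Injective Q) {T : Set α}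
    (hT : ∀ t ∈ T, Q t ∈ convexHull ℝ (Q '' {p, q, r, s})) {v : α}
    (hv : v ∈ ({p, q, r, s} : Set α)) (hvT : Q v ∈ convexHull ℝ (Q '' T)) : v ∈ T := by
  have e : ∀ a b c d : α, ({a, b, c, d} : Set α) = {b, c, d, a} := by
    intro a b c d; ext; simp only [Set.mem_insert_iff, Set.mem_singleton_iff]; tauto
  simp only [Set.mem_insert_iff, Set.mem_singleton_iff] at hv
  rcases hv with rfl | rfl | rfl | rfl
  · exact h.mem_of_mem_hull_first hQ hT hvT
  · exact h.rotate.mem_of_mem_hull_first hQ (by rwa [e] at hT) hvT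
  · exact h.rotate.rotate.mem_of_mem_hull_first hQ (by rwa [e, e] at hT) hvT
  · exact h.rotate.rotate.rotate.mem_of_mem_hull_first hQ (by rwa [e, e, e] at hT) hvT

/-- Every point of the configuration in the hull of a convex quadrilateral that is not one of its
vertices lies strictly inside each edge. -/
theorem orient_pos (h : ConvexQuad Q p q r s) (hg : GenPos Q) {a : α}
    (ha : Q a ∈ convexHull ℝ (Q '' {p, q, r, s})) (hpa : p ≠ a) (hqa : q ≠ a) :
    0 < orient Q p q a := by
  refine lt_of_le_of_ne (orient_nonneg_of_mem_convexHull ?_ ha)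
    (orient_ne_zero hg h.ne.1 hpa hqa).symm
  simp only [Set.mem_insert_iff, Set.mem_singleton_iff, forall_eq_or_imp, forall_eq]
  refine ⟨(orient_self_left _ _).ge, (orient_self_right _ _).ge, h.pos₁.le, ?_⟩
  rw [orient_rotate]
  exact h.pos₄.le

end ConvexQuad

/-- A convex quadrilateral `p q r s` that contains the points of `A` and lies in no triangle of
the configuration, where adding any two points to `A` gives a triangular hull. -/
structure BlockedQuad (Q : α → ℝ × ℝ) (A : Finset α) (p q r s : α) : Prop where
  quad : ConvexQuad Q p q r s
  subset_hull : ∀ a ∈ A, Q a ∈ convexHull ℝ (Q '' {p, q, r, s})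
  triangular : ∀ x y, x ∉ A → y ∉ A → x ≠ y → HasTriangularHull Q (insert x (insert y (A : Set α)))
  blocked : ∀ T : Finset α, T.card = 3 →
    ¬ ∀ t ∈ ({p, q, r, s} : Set α), Q t ∈ convexHull ℝ (Q '' T)

namespace BlockedQuad

variable {A : Finset α}

theorem rotate (h : BlockedQuad Q A p q r s) : BlockedQuad Q A q r s p := by
  have e : ({q, r, s, p} : Set α) = {p, q, r, s} := by
    ext; simp only [Set.mem_insert_iff, Set.mem_singleton_iff]; tauto
  exact ⟨h.quad.rotate, by rw [e]; exact h.subset_hull, h.triangular,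
    by rw [e]; exact h.blocked⟩

theorem exists_triangle (h : BlockedQuad Q A p q r s) (hQ : Function.Injective Q) {x y : α}
    (hxV : x ∈ ({p, q, r, s} : Set α)) (hyV : y ∈ ({p, q, r, s} : Set α)) (hx : x ∉ A) (hy : y ∉ A) (hxy : x ≠ y) :
    ∃ T : Finset α, T.card = 3 ∧ (T : Set α) ⊆ insert x (insert y (A : Set α)) ∧
      (∀ t ∈ insert x (insert y (A : Set α)), Q t ∈ convexHull ℝ (Q '' T)) ∧
      ∀ v ∈ ({p, q, r, s} : Set α), v ∈ insert x (insert y (A : Set α)) → v ∈ T := by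
  obtain ⟨T, hT, hTS, hhull⟩ := h.triangular x y hx hy hxy
  refine ⟨T, hT, hTS, hhull, fun v hv hvS => h.quad.mem_of_mem_hull hQ ?_ hv (hhull v hvS)⟩
  intro t ht
  rcases hTS ht with rfl | rfl | ht
  · exact subset_convexHull ℝ _ ⟨_, hxV, rfl⟩
  · exact subset_convexHull ℝ _ ⟨_, hyV, rfl⟩
  · exact h.subset_hull t ht

theorem card_vertices [DecidableEq α] (h : BlockedQuad Q A p q r s) :
    ({p, q, r, s} : Finset α).card = 4 := by
  obtain ⟨h1, h2, h3, h4, h5, h6⟩ := h.quad.ne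
  simp [*]

theorem not_two (h : BlockedQuad Q A p q r s) (hQ : Function.Injective Q) {x y : α}
    (hxV : x ∈ ({p, q, r, s} : Set α)) (hyV : y ∈ ({p, q, r, s} : Set α)) (hx : x ∉ A) (hy : y ∉ A) (hxy : x ≠ y) :
    ¬ ({p, q, r, s} : Set α) ⊆ insert x (insert y (A : Set α)) := by
  classical
  intro hV
  obtain ⟨T, hT, -, -, hmem⟩ := h.exists_triangle hQ hxV hyV hx hy hxy
  have : ({p, q, r, s} : Finset α) ⊆ T := by
    intro v hv
    have hv' : v ∈ ({p, q, r, s} : Set α) := by simpa using hv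
    exact hmem v hv' (hV hv')
  have := Finset.card_le_card this
  rw [h.card_vertices] at this
  omega

theorem not_subset_vertices [DecidableEq α] (h : BlockedQuad Q A p q r s) (hA : A.card = 3)
    (hy : ∃ y, y ∉ ({p, q, r, s} : Finset α)) : ¬ A ⊆ ({p, q, r, s} : Finset α) := by
  intro hAV
  obtain ⟨y, hy⟩ := hy
  have hcard := h.card_vertices
  obtain ⟨x, hxV, hxA⟩ := Finset.exists_mem_notMem_of_card_lt_card (s := A)
    (t := {p, q, r, s}) (by omega)
  have hV : insert x A = ({p, q, r, s} : Finset α) := by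
    refine Finset.eq_of_subset_of_card_le (Finset.insert_subset hxV hAV) ?_
    rw [Finset.card_insert_of_notMem hxA]
    omega
  obtain ⟨T, hT, -, hhull⟩ := h.triangular x y hxA (fun h => hy (hAV h))
    (by rintro rfl; exact hy hxV)
  refine h.blocked T hT fun t ht => hhull t ?_
  have ht' : t ∈ insert x A := by rw [hV]; simpa using ht
  simp only [Finset.mem_insert] at ht'
  simp only [Set.mem_insert_iff, Finset.mem_coe]
  tauto

theorem not_one (h : BlockedQuad Q A p q r s) (hQ : Function.Injective Q) (hg : GenPos Q)
    (hA : A.card = 3) (hp : p ∈ A)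
    (hq : q ∉ A) (hr : r ∉ A) (hs : s ∉ A) : False := by
  classical
  obtain ⟨hpq, hpr, hps, hqr, hqs, hrs⟩ := h.quad.ne
  obtain ⟨b, hb, hbp⟩ := Finset.exists_mem_ne (by omega : 1 < A.card) p
  have hbr : b ≠ r := by rintro rfl; exact hr hb
  obtain ⟨T, hT, -, hhull, hmem⟩ := h.exists_triangle hQ (x := q) (y := r) (by simp) (by simp)
    hq hr hqr
  obtain ⟨T', hT', -, hhull', hmem'⟩ := h.exists_triangle hQ (x := r) (y := s) (by simp) (by simp)
    hr hs hrs
  have e : ({p, q, r} : Finset α) = T := by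
    refine Finset.eq_of_subset_of_card_le ?_ ?_
    · simp only [Finset.insert_subset_iff, Finset.singleton_subset_iff]
      exact ⟨hmem p (by simp) (by simp [hp]), hmem q (by simp) (by simp),
        hmem r (by simp) (by simp)⟩
    · rw [Finset.card_eq_three.2 ⟨p, q, r, hpq, hpr, hqr, rfl⟩, hT]
  have e' : ({p, r, s} : Finset α) = T' := by
    refine Finset.eq_of_subset_of_card_le ?_ ?_
    · simp only [Finset.insert_subset_iff, Finset.singleton_subset_iff]
      exact ⟨hmem' p (by simp) (by simp [hp]), hmem' r (by simp) (by simp),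
        hmem' s (by simp) (by simp)⟩
    · rw [Finset.card_eq_three.2 ⟨p, r, s, hpr, hps, hrs, rfl⟩, hT']
  have h1 := hhull b (by simp [hb])
  have h2 := hhull' b (by simp [hb])
  rw [← e] at h1
  rw [← e'] at h2
  have o1 : 0 ≤ orient Q r p b := by
    refine orient_nonneg_of_mem_convexHull ?_ h1
    simp only [Finset.coe_insert, Finset.coe_singleton, Set.mem_insert_iff, Set.mem_singleton_iff,
      forall_eq_or_imp, forall_eq, orient_self_left, orient_self_right, le_refl, true_and, and_true]
    rw [orient_rotate, orient_rotate]
    exact h.quad.pos₁.le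
  have o2 : 0 ≤ orient Q p r b := by
    refine orient_nonneg_of_mem_convexHull ?_ h2
    simp only [Finset.coe_insert, Finset.coe_singleton, Set.mem_insert_iff, Set.mem_singleton_iff,
      forall_eq_or_imp, forall_eq, orient_self_left, orient_self_right, le_refl, true_and]
    rw [← orient_rotate]
    exact h.quad.pos₃.le
  have := orient_swap (P := Q) p b r
  have := orient_rotate (P := Q) p b r
  have := orient_rotate (P := Q) b r p
  refine orient_ne_zero hg hpr hbp.symm hbr.symm ?_
  linarith

/-- If `A` misses the quadrilateral then each edge spans, with a point of `A`, a triangle that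
contains `A`. -/
theorem exists_apex (h : BlockedQuad Q A p q r s) (hQ : Function.Injective Q) (hp : p ∉ A)
    (hq : q ∉ A) :
    ∃ a ∈ A, ∀ b ∈ A, Q b ∈ convexHull ℝ (Q '' {p, q, a}) := by
  classical
  have hpq := h.quad.ne.1
  obtain ⟨T, hT, hTS, hhull, hmem⟩ := h.exists_triangle hQ (x := p) (y := q) (by simp) (by simp)
    hp hq hpq
  have hpT := hmem p (by simp) (by simp)
  have hqT := hmem q (by simp) (by simp)
  obtain ⟨a, haT, ha⟩ := Finset.exists_mem_notMem_of_card_lt_card (s := {p, q}) (t := T)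
    (by rw [Finset.card_pair hpq]; omega)
  simp only [Finset.mem_insert, Finset.mem_singleton, not_or] at ha
  have haA : a ∈ A := by
    have := hTS haT
    simp only [Set.mem_insert_iff, Finset.mem_coe] at this
    tauto
  refine ⟨a, haA, fun b hb => ?_⟩
  have e : ({p, q, a} : Finset α) = T := by
    refine Finset.eq_of_subset_of_card_le ?_ ?_
    · simp only [Finset.insert_subset_iff, Finset.singleton_subset_iff]
      exact ⟨hpT, hqT, haT⟩
    · rw [Finset.card_eq_three.2 ⟨p, q, a, hpq, Ne.symm ha.1, Ne.symm ha.2, rfl⟩, hT]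
  have := hhull b (by simp [hb])
  rw [← e] at this
  simpa using this

theorem orient_pos_of_apex (h : BlockedQuad Q A p q r s) (hg : GenPos Q) (hp : p ∉ A)
    (hq : q ∉ A) {a b : α} (ha : a ∈ A)
    (hb : b ∈ A) (hab : a ≠ b) (hh : Q b ∈ convexHull ℝ (Q '' {p, q, a})) :
    0 < orient Q a p b ∧ 0 < orient Q a b q := by
  have ne {x y : α} (hx : x ∈ A) (hy : y ∉ A) : x ≠ y := by rintro rfl; exact hy hx
  have hpos := h.quad.orient_pos hg (h.subset_hull a ha) (ne ha hp).symm (ne ha hq).symm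
  constructor
  · refine lt_of_le_of_ne (orient_nonneg_of_mem_convexHull ?_ hh)
      (orient_ne_zero hg (ne ha hp) hab (ne hb hp).symm).symm
    simp only [Set.mem_insert_iff, Set.mem_singleton_iff,
      forall_eq_or_imp, forall_eq, orient_self_left, orient_self_right, le_refl, true_and, and_true]
    rw [← orient_rotate]
    exact hpos.le
  · rw [← orient_rotate, ← orient_rotate]
    refine lt_of_le_of_ne (orient_nonneg_of_mem_convexHull ?_ hh)
      (orient_ne_zero hg (ne ha hq).symm (ne hb hq).symm hab).symm
    simp only [Set.mem_insert_iff, Set.mem_singleton_iff,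
      forall_eq_or_imp, forall_eq, orient_self_left, orient_self_right, le_refl, and_true]
    rw [orient_rotate]
    exact hpos.le

theorem apex_adjacent (h : BlockedQuad Q A p q r s) (hg : GenPos Q) (hA : A.card = 3) (hp : p ∉ A)
    (hq : q ∉ A) (hr : r ∉ A)
    {a : α} (ha : a ∈ A) (h₁ : ∀ b ∈ A, Q b ∈ convexHull ℝ (Q '' {p, q, a}))
    (h₂ : ∀ b ∈ A, Q b ∈ convexHull ℝ (Q '' {q, r, a})) : False := by
  obtain ⟨b, hb, hba⟩ := Finset.exists_mem_ne (by omega : 1 < A.card) a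
  have := (h.orient_pos_of_apex hg hp hq ha hb hba.symm (h₁ b hb)).2
  have := (h.rotate.orient_pos_of_apex hg hq hr ha hb hba.symm (h₂ b hb)).1
  have := orient_swap (P := Q) a q b
  linarith

theorem apex_opposite (h : BlockedQuad Q A p q r s) (hg : GenPos Q) (hA : A.card = 3) (hp : p ∉ A)
    (hq : q ∉ A) (hr : r ∉ A)
    (hs : s ∉ A) {a : α} (ha : a ∈ A) (h₁ : ∀ b ∈ A, Q b ∈ convexHull ℝ (Q '' {p, q, a}))
    (h₂ : ∀ b ∈ A, Q b ∈ convexHull ℝ (Q '' {r, s, a})) : False := by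
  obtain ⟨b, hb, hba⟩ := Finset.exists_mem_ne (by omega : 1 < A.card) a
  have ne {x y : α} (hx : x ∉ A) (hy : y ∈ A) : x ≠ y := by rintro rfl; exact hx hy
  obtain ⟨pb, bq⟩ := h.orient_pos_of_apex hg hp hq ha hb hba.symm (h₁ b hb)
  obtain ⟨rb, bs⟩ := h.rotate.rotate.orient_pos_of_apex hg hr hs ha hb hba.symm (h₂ b hb)
  have hmem := h.subset_hull a ha
  have qr := h.rotate.quad.orient_pos hg (h.rotate.subset_hull a ha) (ne hq ha) (ne hr ha)
  have rs := h.rotate.rotate.quad.orient_pos hg (h.rotate.rotate.subset_hull a ha)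
    (ne hr ha) (ne hs ha)
  have sp := h.rotate.rotate.rotate.quad.orient_pos hg (h.rotate.rotate.rotate.subset_hull a ha)
    (ne hs ha) (ne hp ha)
  have pq := h.quad.orient_pos hg hmem (ne hp ha) (ne hq ha)
  rw [orient_rotate a] at pq qr rs sp
  have g₁ := orient_grassmann (P := Q) a p q r b
  have g₂ := orient_grassmann (P := Q) a p r s b
  have e₁ := orient_swap (P := Q) a b q
  have e₂ := orient_swap (P := Q) a b s
  have e₃ := orient_swap (P := Q) a s p
  rw [e₁] at g₁
  rw [e₂, e₃] at g₂
  have := mul_pos pq rb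
  have := mul_pos pb qr
  have := mul_pos sp rb
  have := mul_pos pb rs
  have hpr : orient Q a p r < 0 := by
    by_contra! hc
    nlinarith [mul_nonneg hc bq.le]
  nlinarith [mul_pos (neg_pos.2 hpr) bs]

theorem not_zero (h : BlockedQuad Q A p q r s) (hQ : Function.Injective Q) (hg : GenPos Q)
    (hA : A.card = 3) (hp : p ∉ A)
    (hq : q ∉ A) (hr : r ∉ A) (hs : s ∉ A) : False := by
  classical
  obtain ⟨a, ha, h₁⟩ := h.exists_apex hQ hp hq
  obtain ⟨b, hb, h₂⟩ := h.rotate.exists_apex hQ hq hr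
  obtain ⟨c, hc, h₃⟩ := h.rotate.rotate.exists_apex hQ hr hs
  obtain ⟨d, hd, h₄⟩ := h.rotate.rotate.rotate.exists_apex hQ hs hp
  have hab : a ≠ b := by
    rintro rfl; exact h.apex_adjacent hg hA hp hq hr ha h₁ h₂
  have hbc : b ≠ c := by
    rintro rfl; exact h.rotate.apex_adjacent hg hA hq hr hs hb h₂ h₃
  have hcd : c ≠ d := by
    rintro rfl; exact h.rotate.rotate.apex_adjacent hg hA hr hs hp hc h₃ h₄
  have hda : d ≠ a := by
    rintro rfl; exact h.rotate.rotate.rotate.apex_adjacent hg hA hs hp hq hd h₄ h₁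
  have hac : a ≠ c := by
    rintro rfl; exact h.apex_opposite hg hA hp hq hr hs ha h₁ h₃
  have hbd : b ≠ d := by
    rintro rfl; exact h.rotate.apex_opposite hg hA hq hr hs hp hb h₂ h₄
  have hsub : ({a, b, c, d} : Finset α) ⊆ A := by
    simp [Finset.insert_subset_iff, *]
  have := Finset.card_le_card hsub
  have : ({a, b, c, d} : Finset α).card = 4 := by
    simp [hab, hbc, hcd, hac, hbd, hda.symm]
  omega

theorem elim (h : BlockedQuad Q A p q r s) (hQ : Function.Injective Q) (hg : GenPos Q)
    (hA : A.card = 3)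
    (hcard : 5 ≤ Nat.card α) : False := by
  classical
  have hfin : Finite α := Nat.finite_of_card_ne_zero (by omega)
  have := Fintype.ofFinite α
  have h4 := h.card_vertices
  have hy : ∃ y, y ∉ ({p, q, r, s} : Finset α) := by
    by_contra! hc
    have := Finset.card_le_card (fun x _ => hc x : Finset.univ ⊆ ({p, q, r, s} : Finset α))
    rw [Finset.card_univ, ← Nat.card_eq_fintype_card] at this
    omega
  have hnot := h.not_subset_vertices hA hy
  have three {x y z : α} (hx : x ∈ A) (hy : y ∈ A) (hz : z ∈ A) (hxy : x ≠ y) (hxz : x ≠ z)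
      (hyz : y ≠ z) (hxV : x ∈ ({p, q, r, s} : Finset α)) (hyV : y ∈ ({p, q, r, s} : Finset α))
      (hzV : z ∈ ({p, q, r, s} : Finset α)) : False := by
    have e : ({x, y, z} : Finset α) = A := by
      refine Finset.eq_of_subset_of_card_le ?_ ?_
      · simp [Finset.insert_subset_iff, *]
      · rw [Finset.card_eq_three.2 ⟨x, y, z, hxy, hxz, hyz, rfl⟩, hA]
    refine hnot ?_
    rw [← e]
    simp only [Finset.insert_subset_iff, Finset.singleton_subset_iff]
    exact ⟨hxV, hyV, hzV⟩
  obtain ⟨hpq, hpr, hps, hqr, hqs, hrs⟩ := h.quad.ne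
  have two {x y : α} (hx : x ∉ A) (hy : y ∉ A) (hxy : x ≠ y)
      (hxV : x ∈ ({p, q, r, s} : Set α)) (hyV : y ∈ ({p, q, r, s} : Set α))
      (hV : ∀ v ∈ ({p, q, r, s} : Set α), v ∈ insert x (insert y (A : Set α))) : False :=
    h.not_two hQ hxV hyV hx hy hxy hV
  by_cases hp : p ∈ A <;> by_cases hq : q ∈ A <;> by_cases hr : r ∈ A <;> by_cases hs : s ∈ A
  · exact three hp hq hr hpq hpr hqr (by simp) (by simp) (by simp)
  · exact three hp hq hr hpq hpr hqr (by simp) (by simp) (by simp)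
  · exact three hp hq hs hpq hps hqs (by simp) (by simp) (by simp)
  · exact two hr hs hrs (by simp) (by simp) (by simp [*])
  · exact three hp hr hs hpr hps hrs (by simp) (by simp) (by simp)
  · exact two hq hs hqs (by simp) (by simp) (by simp [*])
  · exact two hq hr hqr (by simp) (by simp) (by simp [*])
  · exact h.not_one hQ hg hA hp hq hr hs
  · exact three hq hr hs hqr hqs hrs (by simp) (by simp) (by simp)
  · exact two hp hs hps (by simp) (by simp) (by simp [*])
  · exact two hp hr hpr (by simp) (by simp) (by simp [*])
  · exact h.rotate.not_one hQ hg hA hq hr hs hp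
  · exact two hp hq hpq (by simp) (by simp) (by simp [*])
  · exact h.rotate.rotate.not_one hQ hg hA hr hs hp hq
  · exact h.rotate.rotate.rotate.not_one hQ hg hA hs hp hq hr
  · exact h.not_zero hQ hg hA hp hq hr hs

end BlockedQuad

theorem mem_convexHull_of_two_neg {u v w z : α} (h : 0 < orient Q u v w)
    (h₁ : orient Q u v z < 0) (h₂ : orient Q v w z < 0) :
    Q v ∈ convexHull ℝ {Q u, Q z, Q w} := by
  have e₁ := orient_swap (P := Q) v w z
  have e₂ := orient_rotate (P := Q) v z w
  have e₃ := orient_swap (P := Q) u v z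
  have e₄ := orient_rotate (P := Q) w u v
  have e₅ := orient_decompose (P := Q) u z w v
  exact mem_convexHull_of_orient (by linarith) (by linarith) (by linarith) (by linarith)

theorem false_of_point_beyond_edge (hQ : Function.Injective Q) (hg : GenPos Q)
    (hcard : 5 ≤ Nat.card α) {A : Finset α} (hA : A.card = 3)
    (htri : ∀ x y, x ∉ A → y ∉ A → x ≠ y → HasTriangularHull Q (insert x (insert y (A : Set α))))
    {u v w z : α} (huvw : 0 < orient Q u v w) (hz : orient Q u v z < 0) (hwz : w ≠ z)
    (hAT : ∀ a ∈ A, Q a ∈ convexHull ℝ (Q '' {u, v, w}))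
    (hmax : ∀ T : Finset α, T.card = 3 → ¬ ∀ t ∈ ({u, v, w, z} : Set α),
      Q t ∈ convexHull ℝ (Q '' T)) : False := by
  classical
  obtain ⟨huv, huw, hvw⟩ := ne_of_orient_ne_zero huvw.ne'
  obtain ⟨-, huz, hvz⟩ := ne_of_orient_ne_zero hz.ne
  have huT (t x y z : α) : Q t ∈ convexHull ℝ {Q x, Q y, Q z} ↔
      Q t ∈ convexHull ℝ (Q '' ({x, y, z} : Finset α)) := by
    simp [Set.image_insert_eq]
  have key {x y : α} (hxy : x ≠ y) (hxz : x ≠ z) (hyz : y ≠ z)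
      (h : ∀ t ∈ ({u, v, w, z} : Set α), t = x ∨ t = y ∨ t = z ∨
        Q t ∈ convexHull ℝ {Q x, Q z, Q y}) : False := by
    refine hmax {x, z, y} (Finset.card_eq_three.2 ⟨x, z, y, hxz, hxy, hyz.symm, rfl⟩)
      fun t ht => ?_
    rw [← huT]
    rcases h t ht with rfl | rfl | rfl | h
    · exact subset_convexHull ℝ _ (by simp)
    · exact subset_convexHull ℝ _ (by simp)
    · exact subset_convexHull ℝ _ (by simp)
    · exact h
  have hvwu : 0 < orient Q v w u := by rwa [orient_rotate]
  have hwuv : 0 < orient Q w u v := by rwa [orient_rotate]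
  rcases lt_trichotomy (orient Q v w z) 0 with h₁ | h₁ | h₁
  · refine key huw huz hwz ?_
    simpa [hvw, huv.symm, hvz] using mem_convexHull_of_two_neg huvw hz h₁
  · exact orient_ne_zero hg hvw hvz hwz h₁
  rcases lt_trichotomy (orient Q w u z) 0 with h₂ | h₂ | h₂
  · refine key hvw.symm hwz hvz ?_
    simpa [huv, huw, huz] using mem_convexHull_of_two_neg hwuv h₂ hz
  · exact orient_ne_zero hg huw.symm hwz huz h₂
  have hB : BlockedQuad Q A u z v w := by
    refine ⟨⟨?_, ?_, hvwu, h₂⟩, fun a ha => ?_, htri, fun T hT h => hmax T hT fun t ht => h t ?_⟩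
    · rw [orient_swap]; linarith
    · rwa [← orient_rotate]
    · refine convexHull_mono (Set.image_mono ?_) (hAT a ha)
      intro t
      simp only [Set.mem_insert_iff, Set.mem_singleton_iff]
      tauto
    · simp only [Set.mem_insert_iff, Set.mem_singleton_iff] at ht ⊢
      tauto
  exact hB.elim hQ hg hA hcard

/-- If adding any two points to some fixed triple gives a triangular hull, then the whole
configuration has a triangular hull. -/
theorem exists_triangle_of_pairs [Fintype α] (hQ : Function.Injective Q) (hg : GenPos Q)
    (hcard : 5 ≤ Nat.card α) {A : Finset α} (hA : A.card = 3)
    (htri : ∀ x y, x ∉ A → y ∉ A → x ≠ y →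
      HasTriangularHull Q (insert x (insert y (A : Set α)))) :
    ∃ T : Finset α, T.card = 3 ∧ ∀ i, Q i ∈ convexHull ℝ (Q '' T) := by
  classical
  obtain ⟨T, hTmem, hTmax⟩ := Finset.exists_max_image
    (Finset.univ.filter fun T : Finset α =>
      T.card = 3 ∧ ∀ a ∈ A, Q a ∈ convexHull ℝ (Q '' T))
    (fun T => (Finset.univ.filter fun i => Q i ∈ convexHull ℝ (Q '' T)).card)
    ⟨A, Finset.mem_filter.2 ⟨Finset.mem_univ _, hA, fun a ha =>
      subset_convexHull ℝ _ (Set.mem_image_of_mem Q (Finset.mem_coe.2 ha))⟩⟩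
  simp only [Finset.mem_filter, Finset.mem_univ, true_and] at hTmem hTmax
  obtain ⟨hT, hAT⟩ := hTmem
  refine ⟨T, hT, ?_⟩
  by_contra! hz
  obtain ⟨z, hz⟩ := hz
  have hmax (T' : Finset α) (hT' : T'.card = 3) (hz' : Q z ∈ convexHull ℝ (Q '' T')) :
      ¬ ∀ t ∈ T, Q t ∈ convexHull ℝ (Q '' T') := by
    intro h
    have hsub : convexHull ℝ (Q '' (T : Set α)) ⊆ convexHull ℝ (Q '' T') :=
      convexHull_min (by rintro _ ⟨t, ht, rfl⟩; exact h t ht) (convex_convexHull ℝ _)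
    refine (Finset.card_lt_card ?_).not_ge (hTmax T' ⟨hT', fun a ha => hsub (hAT a ha)⟩)
    rw [Finset.ssubset_iff_of_subset (Finset.monotone_filter_right _ fun i _ hi => hsub hi)]
    exact ⟨z, by simpa using hz', by simpa using hz⟩
  have main {u v w : α} (hTe : ({u, v, w} : Finset α) = T) (huvw : 0 < orient Q u v w) :
      0 ≤ orient Q u v z := by
    by_contra! hneg
    have hset : (T : Set α) = {u, v, w} := by simp [← hTe]
    refine false_of_point_beyond_edge hQ hg hcard hA htri huvw hneg ?_ (by rwa [← hset]) ?_
    · rintro rfl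
      linarith
    · intro T' hT' h
      refine hmax T' hT' (h z (by simp)) fun t ht => h t ?_
      rw [← hTe] at ht
      simp only [Finset.mem_insert, Finset.mem_singleton] at ht
      simp only [Set.mem_insert_iff, Set.mem_singleton_iff]
      tauto
  have inside {u v w : α} (hTe : ({u, v, w} : Finset α) = T) (huvw : 0 < orient Q u v w) :
      False := by
    have rot (x y z : α) : ({y, z, x} : Finset α) = {x, y, z} := by
      rw [Finset.pair_comm z x, Finset.insert_comm]
    have hvwu : 0 < orient Q v w u := by rwa [orient_rotate]
    have hwuv : 0 < orient Q w u v := by rwa [orient_rotate]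
    refine hz ?_
    have := mem_convexHull_of_orient huvw (main (by rw [rot, hTe]) hvwu)
      (main (by rw [rot, rot, hTe]) hwuv) (main hTe huvw)
    rw [← hTe]
    simpa [Set.image_insert_eq] using this
  obtain ⟨u, v, w, huv, huw, hvw, rfl⟩ := Finset.card_eq_three.1 hT
  rcases lt_trichotomy (orient Q u v w) 0 with h | h | h
  · exact inside (by rw [Finset.pair_comm]) (by rw [orient_swap]; linarith : 0 < orient Q u w v)
  · exact orient_ne_zero hg huv huw hvw h
  · exact inside rfl h

theorem mem_extremeSet_of_triangle (hQ : Function.Injective Q) (hg : GenPos Q) {u v w : α}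
    (huv : u ≠ v) (huw : u ≠ w) (hvw : v ≠ w)
    (h : ∀ i, Q i ∈ convexHull ℝ (Q '' {u, v, w})) : u ∈ ExtremeSet Q := by
  intro hu
  have hne := orient_ne_zero hg hvw huv.symm huw.symm
  have := mem_of_strict_max_hull (S := {u, v, w}) (orient Q v w u • detLin (Q w - Q v)) hQ
    ?_ (fun t _ => h t) hu
  · simp at this
  have key (x : α) (hx : orient Q v w x = 0) :
      (orient Q v w u • detLin (Q w - Q v)) (Q x) < (orient Q v w u • detLin (Q w - Q v)) (Q u) := by
    have h1 := detLin_sub_detLin (P := Q) v w u x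
    simp only [LinearMap.smul_apply, smul_eq_mul]
    rw [hx, sub_zero] at h1
    have h2 := mul_self_pos.2 hne
    nth_rewrite 2 [← h1] at h2
    linarith
  simp only [Set.mem_insert_iff, Set.mem_singleton_iff, forall_eq_or_imp, forall_eq]
  exact ⟨fun h => absurd rfl h, fun _ => key _ (orient_self_left _ _),
    fun _ => key _ (orient_self_right _ _)⟩

theorem ncard_extremeSet_eq_three (hQ : Function.Injective Q) (hg : GenPos Q) {T : Finset α}
    (hT : T.card = 3) (h : ∀ i, Q i ∈ convexHull ℝ (Q '' T)) : (ExtremeSet Q).ncard = 3 := by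
  classical
  have rot (x y z : α) : ({x, y, z} : Set α) = {y, z, x} := by
    rw [Set.pair_comm z x, Set.insert_comm]
  suffices hE : ExtremeSet Q = T by rw [hE, Set.ncard_coe_finset, hT]
  refine Set.Subset.antisymm (fun i hi => ?_) ?_
  · by_contra hiT
    refine hi (convexHull_mono (Set.image_mono ?_) (h i))
    rintro t ht rfl
    exact hiT ht
  · obtain ⟨u, v, w, huv, huw, hvw, rfl⟩ := Finset.card_eq_three.1 hT
    simp only [Finset.coe_insert, Finset.coe_singleton] at h ⊢
    simp only [Set.insert_subset_iff, Set.singleton_subset_iff]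
    exact ⟨mem_extremeSet_of_triangle hQ hg huv huw hvw h,
      mem_extremeSet_of_triangle hQ hg hvw huv.symm huw.symm (by rwa [← rot]),
      mem_extremeSet_of_triangle hQ hg huw.symm hvw.symm huv (by rwa [← rot, ← rot])⟩

end ConvexQuadrilateral

/-- if two configurations have the same undirected radial system
and the extreme set of `P` has exactly 3 elements, then so does the extreme
set of `Q`. -/
theorem undirected_triangle_hull_transfers {n : ℕ} (hn : 5 ≤ n)
    (P Q : Fin n → ℝ × ℝ)
    (hPinj : Function.Injective P) (hPgp : GenPos P)
    (hQinj : Function.Injective Q) (hQgp : GenPos Q)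
    (hU : SameUndirected P Q)
    (hext : (ExtremeSet P).ncard = 3) :
    (ExtremeSet Q).ncard = 3 := by
  obtain ⟨a, b, c, hab, hac, hbc, hE⟩ := Set.ncard_eq_three.1 hext
  have hmem (i : Fin n) : P i ∈ convexHull ℝ (P '' {a, b, c}) := by
    rw [← hE]
    exact range_subset_convexHull_extremeSet hPinj ⟨i, rfl⟩
  obtain ⟨T, hT, hhull⟩ := exists_triangle_of_pairs (A := {a, b, c}) hQinj hQgp
    (by simpa using hn) (Finset.card_eq_three.2 ⟨a, b, c, hab, hac, hbc, rfl⟩)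
    fun x y hx hy hxy => by
      simp only [Finset.mem_insert, Finset.mem_singleton, not_or] at hx hy
      have hset : (insert x (insert y (({a, b, c} : Finset (Fin n)) : Set (Fin n)))) =
          {a, b, c, x, y} := by
        ext
        simp only [Finset.coe_insert, Finset.coe_singleton, Set.mem_insert_iff,
          Set.mem_singleton_iff]
        tauto
      rw [hset]
      exact hU.hasTriangularHull hPgp hQgp hab hac (Ne.symm hx.1) (Ne.symm hy.1) hbc
        (Ne.symm hx.2.1) (Ne.symm hy.2.1) (Ne.symm hx.2.2) (Ne.symm hy.2.2) hxy (hmem x) (hmem y)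
  exact ncard_extremeSet_eq_three hQinj hQgp hT hhull
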